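/- Let 1 ≤ p₁ < 2 < p₂ < ∞. Then there exist constants c₂ ≥ c₁ > 0, depending only on p₁ and p₂, such that for every N ∈ ℕ and every k ∈ ℕ with 4k ≤ N one has c₁ · min(1, N^{1/p₂} k^{−1/2}) ≤ d_k(id : ℓ_{p₁}^N → ℓ_{p₂}^N) ≤ c₂ · min(1, N^{1/p₂} k^{−1/2}). -/

import Mathlib

open scoped ENNReal

/-- The `k`-th Kolmogorov number of a continuous linear operator `T : X → Y`. -/
noncomputable def kolmogorovNumber {X Y : Type*} [NormedAddCommGroup X] [NormedSpace ℂ X]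
    [NormedAddCommGroup Y] [NormedSpace ℂ Y] (T : X →L[ℂ] Y) (k : ℕ) : ℝ :=
  sInf { r | ∃ L : Submodule ℂ Y, Module.rank ℂ L < (k : Cardinal) ∧
    r = ⨆ x : {x : X // ‖x‖ ≤ 1}, ⨅ z : L, ‖T x.1 - (z : Y)‖ }

/-- The identity operator `id : ℓ_{p₁}^N → ℓ_{p₂}^N` on `ℂ^N`. -/
noncomputable def lpId (p₁ p₂ : ℝ≥0∞) [Fact (1 ≤ p₁)] [Fact (1 ≤ p₂)] (N : ℕ) :
    PiLp p₁ (fun _ : Fin N => ℂ) →L[ℂ] PiLp p₂ (fun _ : Fin N => ℂ) :=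
  LinearMap.toContinuousLinearMap
    (((WithLp.linearEquiv p₂ ℂ (Fin N → ℂ)).symm.toLinearMap).comp
      (WithLp.linearEquiv p₁ ℂ (Fin N → ℂ)).toLinearMap)

open scoped BigOperators

theorem expect_fin_succ {α : Type*} [Fintype α] {m : ℕ} (F : (Fin (m + 1) → α) → ℝ) :
    𝔼 A, F A = 𝔼 a, 𝔼 A : Fin m → α, F (Fin.cons a A) := by
  rw [← Finset.expect_product', Finset.univ_product_univ]
  exact (Fintype.expect_equiv (Fin.consEquiv fun _ => α) _ _ fun _ => rfl).symm

section Comparison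

variable {α T : Type*} [Fintype α] [InvolutiveNeg α] [Nonempty T]

/-- One step of the symmetrization and contraction argument. -/
theorem expect_iSup_sub_abs_le {φ : α → T → ℝ} (hneg : ∀ a y, φ (-a) y = -φ a y)
    {C : ℝ} (hφ : ∀ a y, |φ a y| ≤ C) {g : T → ℝ} (hg : ∃ D, ∀ y, |g y| ≤ D) :
    𝔼 a, ⨆ y, (g y + (𝔼 b, |φ b y| - |φ a y|)) ≤ 𝔼 a, ⨆ y, (g y + 2 * φ a y) := by
  obtain ⟨D, hD⟩ := hg
  rcases isEmpty_or_nonempty α with hα | hα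
  · simp
  have bdd : ∀ a (ψ : ℝ → ℝ), (∀ x, |ψ x| ≤ 2 * |x|) →
      BddAbove (Set.range fun y => g y + ψ (φ a y)) := by
    intro a ψ hψ
    refine ⟨D + 2 * C, ?_⟩
    rintro _ ⟨y, rfl⟩
    have h1 := abs_le.1 (hD y)
    have h2 := abs_le.1 (hψ (φ a y))
    have h3 := hφ a y
    dsimp only
    linarith [h1.2, h2.2]
  have bpos : ∀ a, BddAbove (Set.range fun y => g y + 2 * |φ a y|) := fun a =>
    bdd a (fun x => 2 * |x|) (fun x => by rw [abs_mul, abs_abs, abs_two])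
  have bneg : ∀ a, BddAbove (Set.range fun y => g y + -(2 * |φ a y|)) := fun a =>
    bdd a (fun x => -(2 * |x|)) (fun x => by rw [abs_neg, abs_mul, abs_abs, abs_two])
  have blin : ∀ a, BddAbove (Set.range fun y => g y + 2 * φ a y) := fun a =>
    bdd a (fun x => 2 * x) (fun x => by rw [abs_mul, abs_two])
  set P : α → ℝ := fun a => ⨆ y, (g y + 2 * |φ a y|) with hP
  set M : α → ℝ := fun a => ⨆ y, (g y + -(2 * |φ a y|)) with hM
  set S : α → ℝ := fun a => ⨆ y, (g y + 2 * φ a y) with hS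
  have step1 : ∀ a, ⨆ y, (g y + (𝔼 b, |φ b y| - |φ a y|)) ≤ 𝔼 b, (P b + M a) / 2 := by
    intro a
    refine ciSup_le fun y => ?_
    have : g y + (𝔼 b, |φ b y| - |φ a y|) = 𝔼 b, (g y + (|φ b y| - |φ a y|)) := by
      rw [Finset.expect_add_distrib, Finset.expect_sub_distrib, Fintype.expect_const,
        Fintype.expect_const]
    rw [this]
    refine Finset.expect_le_expect fun b _ => ?_
    have h1 := le_ciSup (bpos b) y
    have h2 := le_ciSup (bneg a) y
    simp only [hP, hM]
    linarith
  have step2 : ∀ a, P a + M a ≤ S a + S (-a) := by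
    intro a
    have key : ∀ y y', (g y + 2 * |φ a y|) + (g y' + -(2 * |φ a y'|)) ≤ S a + S (-a) := by
      intro y y'
      have h1 := le_ciSup (blin a) y
      have h2 := le_ciSup (blin (-a)) y'
      have h3 := le_ciSup (blin a) y'
      have h4 := le_ciSup (blin (-a)) y
      simp only [hneg] at h2 h4
      have h5 : S (-a) = ⨆ y, (g y + 2 * -φ a y) := by simp only [hS, hneg]
      rw [h5]
      simp only [hS]
      have h6 := abs_sub_abs_le_abs_sub (φ a y) (φ a y')
      rcases abs_cases (φ a y - φ a y') with h | h <;> linarith [h.1]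
    have : P a ≤ S a + S (-a) - M a := ciSup_le fun y => by
      have : M a ≤ S a + S (-a) - (g y + 2 * |φ a y|) := ciSup_le fun y' => by
        linarith [key y y']
      linarith
    linarith
  have hSneg : 𝔼 a, S (-a) = 𝔼 a, S a :=
    Fintype.expect_equiv (Equiv.neg α) _ _ fun _ => rfl
  calc 𝔼 a, ⨆ y, (g y + (𝔼 b, |φ b y| - |φ a y|))
      ≤ 𝔼 a, 𝔼 b, (P b + M a) / 2 := Finset.expect_le_expect fun a _ => step1 a
    _ = (𝔼 a, (P a + M a)) / 2 := by
        simp only [← Finset.expect_div, Finset.expect_add_distrib, Fintype.expect_const]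
    _ ≤ (𝔼 a, (S a + S (-a))) / 2 := by
        exact div_le_div_of_nonneg_right (Finset.expect_le_expect fun a _ => step2 a) zero_le_two
    _ = 𝔼 a, S a := by
        rw [Finset.expect_add_distrib, hSneg]; ring

theorem expect_iSup_sum_sub_abs_le {φ : α → T → ℝ} (hneg : ∀ a y, φ (-a) y = -φ a y)
    {C : ℝ} (hφ : ∀ a y, |φ a y| ≤ C) (m : ℕ) {g : T → ℝ} (hg : ∃ D, ∀ y, |g y| ≤ D) :
    𝔼 A : Fin m → α, ⨆ y, (g y + ∑ i, (𝔼 b, |φ b y| - |φ (A i) y|)) ≤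
      𝔼 A : Fin m → α, ⨆ y, (g y + 2 * ∑ i, φ (A i) y) := by
  induction m generalizing g with
  | zero => simp
  | succ m ih =>
    obtain ⟨D, hD⟩ := hg
    rcases isEmpty_or_nonempty α with hα | hα
    · simp
    have hh : ∀ y, |(𝔼 b, |φ b y|)| ≤ C := fun y =>
      (Finset.abs_expect_le _ _).trans
        (Finset.expect_le Finset.univ_nonempty fun b _ => by rw [abs_abs]; exact hφ b y)
    rw [expect_fin_succ, expect_fin_succ]
    simp only [Fin.sum_univ_succ, Fin.cons_zero, Fin.cons_succ]
    calc _ = 𝔼 a, 𝔼 A : Fin m → α, ⨆ y, ((g y + (𝔼 b, |φ b y| - |φ a y|)) +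
            ∑ i, (𝔼 b, |φ b y| - |φ (A i) y|)) := by simp only [add_assoc]
      _ ≤ 𝔼 a, 𝔼 A : Fin m → α, ⨆ y, ((g y + (𝔼 b, |φ b y| - |φ a y|)) +
            2 * ∑ i, φ (A i) y) := by
          refine Finset.expect_le_expect fun a _ => ih ⟨D + (C + C), fun y => ?_⟩
          refine (abs_add_le _ _).trans (add_le_add (hD y) ((abs_sub _ _).trans ?_))
          rw [abs_abs]
          exact add_le_add (hh y) (hφ a y)
      _ = 𝔼 A : Fin m → α, 𝔼 a, ⨆ y, ((g y + 2 * ∑ i, φ (A i) y) +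
            (𝔼 b, |φ b y| - |φ a y|)) := by
          rw [Finset.expect_comm]
          simp only [add_right_comm]
      _ ≤ 𝔼 A : Fin m → α, 𝔼 a, ⨆ y, ((g y + 2 * ∑ i, φ (A i) y) + 2 * φ a y) := by
          refine Finset.expect_le_expect fun A _ =>
            expect_iSup_sub_abs_le hneg hφ ⟨D + 2 * (m * C), fun y => ?_⟩
          refine (abs_add_le _ _).trans (add_le_add (hD y) ?_)
          rw [abs_mul, abs_two]
          gcongr
          refine (Finset.abs_sum_le_sum_abs _ _).trans
            ((Finset.sum_le_sum fun i _ => hφ (A i) y).trans ?_)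
          simp
      _ = _ := by
          rw [Finset.expect_comm]
          simp only [mul_add, add_assoc, add_comm (2 * φ _ _)]

end Comparison

section Signs

theorem expect_pi_prod {ι β : Type*} [Fintype ι] [DecidableEq ι] [Fintype β]
    {K : Type*} [Field K] [CharZero K] (f : ι → β → K) :
    𝔼 a : ι → β, ∏ i, f i (a i) = ∏ i, 𝔼 b, f i b := by
  simp only [Fintype.expect_eq_sum_div_card, Finset.prod_div_distrib, Finset.prod_univ_sum,
    Fintype.piFinset_univ]
  simp

theorem expect_units_int {K : Type*} [Field K] [CharZero K] (f : ℤˣ → K) :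
    𝔼 u, f u = (f 1 + f (-1)) / 2 := by
  rw [Fintype.expect_eq_sum_div_card, UnitsInt.univ, Finset.sum_pair (by decide)]
  simp

theorem expect_cos_signs {N : ℕ} (y : Fin N → ℝ) :
    𝔼 a : Fin N → ℤˣ, Real.cos (∑ j, ((a j : ℤ) : ℝ) * y j) = ∏ j, Real.cos (y j) := by
  have h : 𝔼 a : Fin N → ℤˣ, Complex.exp ((∑ j, ((a j : ℤ) : ℝ) * y j : ℝ) * Complex.I) =
      ((∏ j, Real.cos (y j) : ℝ) : ℂ) := by
    have : ∀ a : Fin N → ℤˣ, Complex.exp ((∑ j, ((a j : ℤ) : ℝ) * y j : ℝ) * Complex.I) =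
        ∏ j, Complex.exp (((a j : ℤ) : ℂ) * y j * Complex.I) := by
      intro a
      rw [← Complex.exp_sum]
      push_cast
      rw [Finset.sum_mul]
    simp only [this]
    rw [expect_pi_prod fun j (u : ℤˣ) => Complex.exp (((u : ℤ) : ℂ) * y j * Complex.I)]
    push_cast
    refine Finset.prod_congr rfl fun j _ => ?_
    rw [expect_units_int, Complex.cos]
    simp
  rw [Fintype.expect_eq_sum_div_card] at h ⊢
  have h2 := congrArg Complex.re h
  rw [Complex.div_natCast_re, Complex.re_sum, Complex.ofReal_re] at h2
  simpa only [Complex.exp_ofReal_mul_I_re] using h2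

theorem expect_abs_signs {N : ℕ} (y : Fin N → ℝ) (hy : ∑ j, y j ^ 2 = 1) :
    1 - Real.exp (-(2 / Real.pi ^ 2)) ≤ 𝔼 a : Fin N → ℤˣ, |∑ j, ((a j : ℤ) : ℝ) * y j| := by
  have hy1 : ∀ j, |y j| ≤ 1 := fun j => by
    rw [← sq_le_one_iff_abs_le_one, ← hy]
    exact Finset.single_le_sum (f := fun j => y j ^ 2) (fun _ _ => sq_nonneg _)
      (Finset.mem_univ j)
  have h1 : ∏ j, Real.cos (y j) ≤ Real.exp (-(2 / Real.pi ^ 2)) := by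
    calc ∏ j, Real.cos (y j) ≤ ∏ j, Real.exp (-(2 / Real.pi ^ 2) * y j ^ 2) := by
          refine Finset.prod_le_prod (fun j _ => ?_) fun j _ => ?_
          · have := abs_le.1 (hy1 j)
            have := Real.pi_gt_three
            exact Real.cos_nonneg_of_neg_pi_div_two_le_of_le (by linarith) (by linarith)
          · have h2 := Real.cos_le_one_sub_mul_cos_sq (x := y j)
              ((hy1 j).trans (by linarith [Real.pi_gt_three]))
            have h3 := Real.add_one_le_exp (-(2 / Real.pi ^ 2) * y j ^ 2)
            linarith
      _ = _ := by
          rw [← Real.exp_sum, ← Finset.mul_sum, hy, mul_one]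
  have h2 : ∀ x : ℝ, 1 - Real.cos x ≤ |x| := by
    intro x
    have := Real.abs_cos_sub_cos_le 0 x
    rw [Real.cos_zero, zero_sub, abs_neg] at this
    exact (le_abs_self _).trans this
  calc 1 - Real.exp (-(2 / Real.pi ^ 2))
      ≤ 1 - ∏ j, Real.cos (y j) := by linarith
    _ = 𝔼 a : Fin N → ℤˣ, (1 - Real.cos (∑ j, ((a j : ℤ) : ℝ) * y j)) := by
        rw [Finset.expect_sub_distrib, Fintype.expect_const, expect_cos_signs]
    _ ≤ _ := Finset.expect_le_expect fun a _ => h2 _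

theorem expect_exp_signs {m N : ℕ} (j : Fin N) (l : ℝ) :
    𝔼 A : Fin m → Fin N → ℤˣ, Real.exp (l * ∑ i, ((A i j : ℤ) : ℝ)) = Real.cosh l ^ m := by
  have h1 : 𝔼 a : Fin N → ℤˣ, Real.exp (l * ((a j : ℤ) : ℝ)) = Real.cosh l := by
    have := expect_pi_prod fun (i : Fin N) (u : ℤˣ) =>
      if i = j then Real.exp (l * ((u : ℤ) : ℝ)) else 1
    simp only [Finset.prod_ite_eq', Finset.mem_univ, if_true] at this
    rw [this, Finset.prod_eq_single j]
    · simp only [if_true]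
      rw [expect_units_int, Real.cosh_eq]
      simp
    · intro b _ hb; simp [hb]
    · simp
  have := expect_pi_prod fun (_ : Fin m) (a : Fin N → ℤˣ) => Real.exp (l * ((a j : ℤ) : ℝ))
  simp only [← Real.exp_sum, ← Finset.mul_sum, h1] at this
  simpa using this

end Signs

section RandomKernel

theorem one_le_toReal {p : ℝ≥0∞} [Fact (1 ≤ p)] (hp : p ≠ ∞) : 1 ≤ p.toReal := by
  have := (ENNReal.toReal_le_toReal ENNReal.one_ne_top hp).2 (Fact.out : 1 ≤ p)
  simpa using this

theorem rpow_le_one_add_factorial_mul_exp {P t : ℝ} (hP : 0 ≤ P) (ht : 0 ≤ t) :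
    t ^ P ≤ 1 + (⌈P⌉₊.factorial : ℝ) * Real.exp t := by
  have hexp := Real.exp_pos t
  rcases le_total t 1 with h | h
  · have := Real.rpow_le_one ht h hP
    have : (0 : ℝ) ≤ (⌈P⌉₊.factorial : ℝ) * Real.exp t := by positivity
    linarith
  · have h1 : t ^ P ≤ t ^ ⌈P⌉₊ := by
      rw [← Real.rpow_natCast]
      exact Real.rpow_le_rpow_of_exponent_le h (Nat.le_ceil P)
    have h2 := Real.pow_div_factorial_le_exp t ht ⌈P⌉₊
    rw [div_le_iff₀' (by positivity)] at h2
    linarith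

theorem expect_rpow_signs_le {P : ℝ} (hP : 0 ≤ P) {m N : ℕ} (hm : 1 ≤ m) (j : Fin N) :
    𝔼 A : Fin m → Fin N → ℤˣ, |(∑ i, ((A i j : ℤ) : ℝ)) / √m| ^ P ≤
      1 + (⌈P⌉₊.factorial : ℝ) * (2 * Real.exp (1 / 2)) := by
  have hm0 : (0 : ℝ) < m := by exact_mod_cast hm
  have hcosh : ∀ l : ℝ, l ^ 2 = 1 / m →
      𝔼 A : Fin m → Fin N → ℤˣ, Real.exp (l * ∑ i, ((A i j : ℤ) : ℝ)) ≤ Real.exp (1 / 2) := by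
    intro l hl
    rw [expect_exp_signs]
    calc Real.cosh l ^ m ≤ Real.exp (l ^ 2 / 2) ^ m :=
          pow_le_pow_left₀ (Real.cosh_pos l).le (Real.cosh_le_exp_half_sq l) m
      _ = Real.exp (1 / 2) := by
          rw [← Real.exp_nat_mul, hl]
          congr 1
          field_simp
  have hsq : (1 / √(m : ℝ)) ^ 2 = 1 / m := by rw [div_pow, Real.sq_sqrt hm0.le, one_pow]
  calc _ ≤ 𝔼 A : Fin m → Fin N → ℤˣ, (1 + (⌈P⌉₊.factorial : ℝ) *
          (Real.exp (1 / √m * ∑ i, ((A i j : ℤ) : ℝ)) +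
            Real.exp (-(1 / √m) * ∑ i, ((A i j : ℤ) : ℝ)))) := by
        refine Finset.expect_le_expect fun A _ => ?_
        refine (rpow_le_one_add_factorial_mul_exp hP (abs_nonneg _)).trans ?_
        gcongr
        set S := ∑ i, ((A i j : ℤ) : ℝ)
        rw [neg_mul, one_div_mul_eq_div]
        rcases abs_cases (S / √m) with h | h <;> rw [h.1] <;>
          linarith [Real.exp_pos (S / √m), Real.exp_pos (-(S / √m))]
    _ ≤ _ := by
        rw [Finset.expect_add_distrib, Fintype.expect_const, ← Finset.mul_expect,
          Finset.expect_add_distrib]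
        have h1 := hcosh _ hsq
        have h2 := hcosh (-(1 / √m)) (by rw [neg_sq, hsq])
        gcongr
        linarith

/-- The expected `ℓ_p`-norm of a sum of `m` independent random sign vectors. -/
theorem exists_expect_norm_signs_le (p : ℝ≥0∞) [Fact (1 ≤ p)] (hp : p ≠ ∞) :
    ∃ C : ℝ, 0 < C ∧ ∀ m N : ℕ, 1 ≤ m → 1 ≤ N →
      𝔼 A : Fin m → Fin N → ℤˣ,
        ‖WithLp.toLp p (fun j => ((∑ i, ((A i j : ℤ) : ℝ) : ℝ) : ℂ))‖ ≤
          C * (√m * (N : ℝ) ^ (p⁻¹).toReal) := by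
  set P := p.toReal with hPdef
  have hP1 : 1 ≤ P := one_le_toReal hp
  have hP0 : 0 < P := by linarith
  set K : ℝ := 1 + (⌈P⌉₊.factorial : ℝ) * (2 * Real.exp (1 / 2)) with hK
  have hK0 : 0 < K := by positivity
  refine ⟨1 + K, by positivity, fun m N hm hN => ?_⟩
  have hm0 : (0 : ℝ) < m := by exact_mod_cast hm
  have hN0 : (0 : ℝ) < N := by exact_mod_cast hN
  have hs : 0 < √(m : ℝ) := Real.sqrt_pos.2 hm0
  have hpt : ∀ v : Fin N → ℝ, ‖WithLp.toLp p (fun j => (v j : ℂ))‖ ≤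
      (√m * (N : ℝ) ^ (p⁻¹).toReal) * (1 + (1 / N) * ∑ j, |v j / √m| ^ P) := by
    intro v
    rw [PiLp.norm_eq_sum hP0, ENNReal.toReal_inv]
    simp only [Complex.norm_real, Real.norm_eq_abs]
    have h1 : ∑ j, |v j| ^ P = √m ^ P * N * ((1 / N) * ∑ j, |v j / √m| ^ P) := by
      have : ∀ j, |v j| ^ P = √m ^ P * |v j / √m| ^ P := by
        intro j
        rw [← Real.mul_rpow hs.le (abs_nonneg _), abs_div, abs_of_pos hs, mul_div_cancel₀ _ hs.ne']
      simp only [this, ← Finset.mul_sum]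
      field_simp
    have h0 : 0 ≤ (1 / (N : ℝ)) * ∑ j, |v j / √m| ^ P := by positivity
    rw [h1, Real.mul_rpow (by positivity) h0, Real.mul_rpow (by positivity) hN0.le, one_div P,
      ← hPdef, Real.rpow_rpow_inv hs.le hP0.ne']
    gcongr
    set x := (1 / (N : ℝ)) * ∑ j, |v j / √m| ^ P
    rcases le_total x 1 with h | h
    · linarith [Real.rpow_le_one h0 h (inv_nonneg.2 hP0.le)]
    · have := Real.rpow_le_rpow_of_exponent_le h (inv_le_one_of_one_le₀ hP1)
      rw [Real.rpow_one] at this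
      linarith
  calc _ ≤ 𝔼 A : Fin m → Fin N → ℤˣ, (√m * (N : ℝ) ^ (p⁻¹).toReal) *
          (1 + (1 / N) * ∑ j, |(∑ i, ((A i j : ℤ) : ℝ)) / √m| ^ P) :=
        Finset.expect_le_expect fun A _ => hpt _
    _ = (√m * (N : ℝ) ^ (p⁻¹).toReal) * (1 + (1 / N) * ∑ j : Fin N,
          𝔼 A : Fin m → Fin N → ℤˣ, |(∑ i, ((A i j : ℤ) : ℝ)) / √m| ^ P) := by
        rw [← Finset.mul_expect, Finset.expect_add_distrib, Fintype.expect_const,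
          ← Finset.mul_expect, Finset.expect_sum_comm]
    _ ≤ (√m * (N : ℝ) ^ (p⁻¹).toReal) * (1 + (1 / N) * ∑ _j : Fin N, K) := by
        gcongr with j
        exact expect_rpow_signs_le hP0.le hm j
    _ = _ := by
        rw [Finset.sum_const, Finset.card_univ, Fintype.card_fin, nsmul_eq_mul]
        field_simp

/-- Some `m × N` sign matrix has the property that on its kernel the Euclidean norm is controlled
by the norm dual to `ℓ_p`. -/
theorem exists_signs_kernel (p : ℝ≥0∞) [Fact (1 ≤ p)] (hp : p ≠ ∞) :
    ∃ C : ℝ, 0 < C ∧ ∀ m N : ℕ, 1 ≤ m → 1 ≤ N → ∃ A : Fin m → Fin N → ℤˣ, ∀ y : Fin N → ℝ,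
      (∀ x : Fin N → ℝ, ∑ j, x j * y j ≤ ‖WithLp.toLp p (fun j => (x j : ℂ))‖) →
      (∀ i, ∑ j, ((A i j : ℤ) : ℝ) * y j = 0) →
      √(∑ j, y j ^ 2) ≤ C * ((N : ℝ) ^ (p⁻¹).toReal / √m) := by
  obtain ⟨K, hK, hKE⟩ := exists_expect_norm_signs_le p hp
  set c : ℝ := 1 - Real.exp (-(2 / Real.pi ^ 2)) with hc
  have hc0 : 0 < c := by
    have : Real.exp (-(2 / Real.pi ^ 2)) < 1 := Real.exp_lt_one_iff.2 (by
      have := Real.pi_pos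
      simp only [Left.neg_neg_iff]; positivity)
    linarith
  refine ⟨4 * K / c, by positivity, fun m N hm hN => ?_⟩
  have hm0 : (0 : ℝ) < m := by exact_mod_cast hm
  have hN0 : (0 : ℝ) < N := by exact_mod_cast hN
  have hs : 0 < √(m : ℝ) := Real.sqrt_pos.2 hm0
  set W : ℝ := (N : ℝ) ^ (p⁻¹).toReal with hW
  have hW0 : 0 < W := Real.rpow_pos_of_pos hN0 _
  by_contra! hcon
  set ρ : ℝ := c * √m / (4 * K * W) with hρ
  have hρ0 : 0 < ρ := by positivity
  let T := {y : Fin N → ℝ // ∑ j, y j ^ 2 = 1 ∧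
    ∀ x : Fin N → ℝ, ∑ j, x j * y j ≤ ρ * ‖WithLp.toLp p (fun j => (x j : ℂ))‖}
  have hT : ∀ A : Fin m → Fin N → ℤˣ, ∃ y : T, ∀ i, ∑ j, ((A i j : ℤ) : ℝ) * y.1 j = 0 := by
    intro A
    obtain ⟨y, hy1, hy2, hy3⟩ := hcon A
    set s := √(∑ j, y j ^ 2) with hsdef
    have hs0 : 0 < s := lt_of_le_of_lt (by positivity) hy3
    have hsρ : s⁻¹ ≤ ρ := by
      rw [inv_le_comm₀ hs0 hρ0]
      refine le_of_eq_of_le ?_ hy3.le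
      rw [hρ]
      field_simp
    have hmul : ∀ x : Fin N → ℝ, ∑ j, x j * (s⁻¹ * y j) = s⁻¹ * ∑ j, x j * y j := fun x => by
      rw [Finset.mul_sum]
      exact Finset.sum_congr rfl fun j _ => by ring
    refine ⟨⟨fun j => s⁻¹ * y j, ?_, fun x => ?_⟩, fun i => ?_⟩
    · simp only [mul_pow, ← Finset.mul_sum]
      rw [← Real.sq_sqrt (show 0 ≤ ∑ j, y j ^ 2 by positivity), ← hsdef, ← mul_pow,
        inv_mul_cancel₀ hs0.ne', one_pow]
    · rw [hmul]
      exact (mul_le_mul_of_nonneg_left (hy1 x) (by positivity)).trans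
        (mul_le_mul_of_nonneg_right hsρ (norm_nonneg _))
    · rw [hmul, hy2 i, mul_zero]
  have : Nonempty T := ⟨(hT fun _ _ => 1).choose⟩
  let φ : (Fin N → ℤˣ) → T → ℝ := fun a y => ∑ j, ((a j : ℤ) : ℝ) * y.1 j
  have hφneg : ∀ a y, φ (-a) y = -φ a y := fun a y => by simp [φ]
  have hφ : ∀ a y, |φ a y| ≤ N := by
    intro a y
    refine (Finset.abs_sum_le_sum_abs _ _).trans ?_
    have : ∀ j ∈ Finset.univ, |((a j : ℤ) : ℝ) * y.1 j| ≤ 1 := by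
      intro j _
      have h1 : |((a j : ℤ) : ℝ)| = 1 := by
        rcases Int.units_eq_one_or (a j) with h | h <;> simp [h]
      rw [abs_mul, h1, one_mul, ← sq_le_one_iff_abs_le_one]
      exact (Finset.single_le_sum (f := fun j => y.1 j ^ 2) (fun _ _ => sq_nonneg _)
        (Finset.mem_univ j)).trans_eq y.2.1
    simpa using Finset.sum_le_sum this
  have main := expect_iSup_sum_sub_abs_le hφneg hφ m (g := fun _ => 0) ⟨0, by simp⟩
  have lower : m * c ≤ 𝔼 A : Fin m → Fin N → ℤˣ,
      ⨆ y, ((0 : ℝ) + ∑ i, (𝔼 b, |φ b y| - |φ (A i) y|)) := by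
    refine Finset.le_expect Finset.univ_nonempty fun A _ => ?_
    obtain ⟨y, hy⟩ := hT A
    refine le_trans ?_ (le_ciSup ⟨(m * N : ℝ), ?_⟩ y)
    · have h1 : ∀ i, φ (A i) y = 0 := hy
      simp only [h1, abs_zero, sub_zero, zero_add, Finset.sum_const, Finset.card_univ,
        Fintype.card_fin, nsmul_eq_mul]
      gcongr
      exact expect_abs_signs y.1 y.2.1
    · rintro _ ⟨z, rfl⟩
      have h1 : ∀ i ∈ Finset.univ, (𝔼 b, |φ b z|) - |φ (A i) z| ≤ N := fun i _ => by
        have := Finset.expect_le Finset.univ_nonempty (fun b _ => hφ b z)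
        linarith [abs_nonneg (φ (A i) z)]
      simpa using Finset.sum_le_sum h1
  have upper : 𝔼 A : Fin m → Fin N → ℤˣ, ⨆ y, ((0 : ℝ) + 2 * ∑ i, φ (A i) y) ≤
      2 * ρ * (K * (√m * W)) := by
    refine le_trans ?_ (mul_le_mul_of_nonneg_left (hKE m N hm hN) (by positivity))
    rw [Finset.mul_expect]
    refine Finset.expect_le_expect fun A _ => ciSup_le fun y => ?_
    have h1 : ∑ i, φ (A i) y = ∑ j, (∑ i, ((A i j : ℤ) : ℝ)) * y.1 j := by
      simp only [φ, Finset.sum_mul]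
      exact Finset.sum_comm
    rw [h1, zero_add, mul_assoc]
    gcongr
    exact y.2.2 _
  have h2 : 2 * ρ * (K * (√m * W)) = m * c / 2 := by
    rw [hρ]
    field_simp
    rw [Real.sq_sqrt hm0.le]
    ring
  have h3 : 0 < m * c := by positivity
  linarith

end RandomKernel

section Duality

theorem iInf_norm_sub_le_of_dual {V : Type*} [NormedAddCommGroup V] [NormedSpace ℂ V]
    (L : Submodule ℂ V) (v : V) {d : ℝ}
    (h : ∀ f : V →L[ℂ] ℂ, ‖f‖ ≤ 1 → (∀ z ∈ L, f z = 0) → ‖f v‖ ≤ d) :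
    ⨅ z : L, ‖v - z‖ ≤ d := by
  obtain ⟨g, hg, hgv⟩ := exists_dual_vector'' ℂ (Submodule.Quotient.mk v : V ⧸ L)
  have key := h (g.comp L.mkQL) ?_ ?_
  · have h1 : (g.comp L.mkQL) v = (‖(Submodule.Quotient.mk v : V ⧸ L)‖ : ℂ) := hgv
    rw [h1, Complex.norm_real, norm_norm] at key
    refine le_trans (le_of_eq ?_) key
    have h2 : ‖(Submodule.Quotient.mk v : V ⧸ L)‖ = Metric.infDist v (L : Set V) :=
      QuotientAddGroup.norm_mk (S := L.toAddSubgroup) v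
    rw [h2, Metric.infDist_eq_iInf]
    simp only [dist_eq_norm]
    rfl
  · refine ContinuousLinearMap.opNorm_le_bound _ zero_le_one fun x => ?_
    rw [one_mul]
    calc ‖g (Submodule.Quotient.mk x : V ⧸ L)‖
        ≤ ‖g‖ * ‖(Submodule.Quotient.mk x : V ⧸ L)‖ := g.le_opNorm _
      _ ≤ 1 * ‖x‖ := mul_le_mul hg (Submodule.Quotient.norm_mk_le L x) (norm_nonneg _) zero_le_one
      _ = ‖x‖ := one_mul _
  · intro z hz
    have : (Submodule.Quotient.mk z : V ⧸ L) = 0 := (Submodule.Quotient.mk_eq_zero L).2 hz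
    change g (Submodule.Quotient.mk z) = 0
    rw [this, map_zero]

theorem iInf_norm_sub_span_signs_le {p : ℝ≥0∞} [Fact (1 ≤ p)] {m N : ℕ}
    {A : Fin m → Fin N → ℤˣ} {D : ℝ}
    (hA : ∀ y : Fin N → ℝ,
      (∀ x : Fin N → ℝ, ∑ j, x j * y j ≤ ‖WithLp.toLp p (fun j => (x j : ℂ))‖) →
      (∀ i, ∑ j, ((A i j : ℤ) : ℝ) * y j = 0) → √(∑ j, y j ^ 2) ≤ D)
    (x : Fin N → ℂ) (hx : ∑ j, ‖x j‖ ^ 2 ≤ 1) :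
    ⨅ z : Submodule.span ℂ (Set.range fun i => (WithLp.toLp p fun j => ((A i j : ℤ) : ℂ))),
      ‖WithLp.toLp p x - z‖ ≤ 2 * D := by
  refine iInf_norm_sub_le_of_dual _ _ fun f hf hfL => ?_
  set y : Fin N → ℂ := fun j => f (WithLp.toLp p (Pi.single j 1)) with hy
  have hfy : ∀ w : Fin N → ℂ, f (WithLp.toLp p w) = ∑ j, w j * y j := by
    intro w
    have : WithLp.toLp p w = ∑ j, w j • WithLp.toLp p (Pi.single j (1 : ℂ)) := by
      simp only [← WithLp.toLp_smul, ← WithLp.toLp_sum]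
      congr 1
      ext j
      simp [Finset.sum_apply, Pi.single_apply]
    rw [this, map_sum]
    simp [hy]
  have hbound : ∀ w : Fin N → ℝ, ‖f (WithLp.toLp p fun j => (w j : ℂ))‖ ≤
      ‖WithLp.toLp p (fun j => (w j : ℂ))‖ := fun w =>
    (f.le_opNorm _).trans (mul_le_of_le_one_left (norm_nonneg _) hf)
  have hker : ∀ i, ∑ j, ((A i j : ℤ) : ℂ) * y j = 0 := fun i => by
    rw [← hfy]
    exact hfL _ (Submodule.subset_span ⟨i, rfl⟩)
  have hre : √(∑ j, (y j).re ^ 2) ≤ D := by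
    refine hA _ (fun w => ?_) fun i => ?_
    · have h1 : ∑ j, w j * (y j).re = (f (WithLp.toLp p fun j => (w j : ℂ))).re := by
        rw [hfy, Complex.re_sum]
        simp
      rw [h1]
      exact (Complex.re_le_norm _).trans (hbound w)
    · have := congrArg Complex.re (hker i)
      rw [Complex.re_sum] at this
      simpa using this
  have him : √(∑ j, (y j).im ^ 2) ≤ D := by
    refine hA _ (fun w => ?_) fun i => ?_
    · have h1 : ∑ j, w j * (y j).im = (f (WithLp.toLp p fun j => (w j : ℂ))).im := by
        rw [hfy, Complex.im_sum]
        simp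
      rw [h1]
      exact (le_abs_self _).trans ((Complex.abs_im_le_norm _).trans (hbound w))
    · have := congrArg Complex.im (hker i)
      rw [Complex.im_sum] at this
      simpa using this
  have hcs : ∀ u : Fin N → ℝ, ∑ j, ‖x j‖ * |u j| ≤ √(∑ j, u j ^ 2) := by
    intro u
    have h1 := Real.sum_mul_le_sqrt_mul_sqrt Finset.univ (fun j => ‖x j‖) fun j => |u j|
    simp only [sq_abs] at h1
    exact h1.trans (mul_le_of_le_one_left (Real.sqrt_nonneg _) (Real.sqrt_le_one.2 hx))
  calc ‖f (WithLp.toLp p x)‖ ≤ ∑ j, ‖x j * y j‖ := by rw [hfy]; exact norm_sum_le _ _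
    _ ≤ ∑ j, (‖x j‖ * |(y j).re| + ‖x j‖ * |(y j).im|) := by
        refine Finset.sum_le_sum fun j _ => ?_
        rw [norm_mul, ← mul_add]
        gcongr
        exact Complex.norm_le_abs_re_add_abs_im _
    _ ≤ 2 * D := by
        rw [Finset.sum_add_distrib]
        have h1 := (hcs fun j => (y j).re).trans hre
        have h2 := (hcs fun j => (y j).im).trans him
        linarith

end Duality

section LpNorm

theorem sum_norm_rpow_le_one {p : ℝ≥0∞} [Fact (1 ≤ p)] (hp : p ≠ ∞) {N : ℕ}
    {x : PiLp p fun _ : Fin N => ℂ} (hx : ‖x‖ ≤ 1) {q : ℝ} (hq : p.toReal ≤ q) :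
    ∑ j, ‖x j‖ ^ q ≤ 1 := by
  have hp1 := one_le_toReal hp
  have h1 : ∑ j, ‖x j‖ ^ p.toReal ≤ 1 := by
    rw [PiLp.norm_eq_sum (by linarith)] at hx
    by_contra! h
    exact absurd hx (not_le.2 (Real.one_lt_rpow h (by positivity)))
  refine (Finset.sum_le_sum fun j _ => ?_).trans h1
  rcases (norm_nonneg (x j)).eq_or_lt with h | h
  · rw [← h, Real.zero_rpow (by linarith), Real.zero_rpow (by linarith)]
  · exact Real.rpow_le_rpow_of_exponent_ge h ((PiLp.norm_apply_le x j).trans hx) hq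

theorem norm_lpId_le_one {p₁ p₂ : ℝ≥0∞} [Fact (1 ≤ p₁)] [Fact (1 ≤ p₂)] (h : p₁ ≤ p₂)
    (h₂ : p₂ ≠ ∞) {N : ℕ} {x : PiLp p₁ fun _ : Fin N => ℂ} (hx : ‖x‖ ≤ 1) :
    ‖lpId p₁ p₂ N x‖ ≤ 1 := by
  have h₁ : p₁ ≠ ∞ := ne_top_of_le_ne_top h₂ h
  have hp := one_le_toReal h₂
  rw [PiLp.norm_eq_sum (by linarith)]
  exact Real.rpow_le_one (by positivity)
    (sum_norm_rpow_le_one h₁ hx ((ENNReal.toReal_le_toReal h₁ h₂).2 h)) (by positivity)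

theorem sum_norm_sq_le {p : ℝ≥0∞} [Fact (1 ≤ p)] (hp2 : 2 < p) (hp : p ≠ ∞) {N : ℕ} (hN : 1 ≤ N)
    (x : PiLp p fun _ : Fin N => ℂ) :
    ∑ j, ‖x j‖ ^ 2 ≤ N / ((N : ℝ) ^ (p⁻¹).toReal) ^ 2 * ‖x‖ ^ 2 := by
  set P := p.toReal with hP
  have hP2 : 2 < P := by
    have := (ENNReal.toReal_lt_toReal ENNReal.ofNat_ne_top hp).2 hp2
    simpa using this
  have hN0 : (0 : ℝ) < N := by exact_mod_cast hN
  have h1 := Real.rpow_sum_le_const_mul_sum_rpow Finset.univ (fun j => ‖x j‖ ^ 2)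
    (show 1 ≤ P / 2 by linarith)
  have h2 : ∀ j, |‖x j‖ ^ 2| ^ (P / 2) = ‖x j‖ ^ P := fun j => by
    rw [abs_of_nonneg (by positivity), ← Real.rpow_natCast, ← Real.rpow_mul (norm_nonneg _)]
    congr 1
    push_cast
    ring
  have h3 : ∑ j, ‖x j‖ ^ P = ‖x‖ ^ P := by
    rw [PiLp.norm_eq_sum (by linarith), one_div, Real.rpow_inv_rpow (by positivity) (by linarith)]
  simp only [h2, h3, Finset.card_univ, Fintype.card_fin] at h1
  have h4 : ∀ j, |‖x j‖ ^ 2| = ‖x j‖ ^ 2 := fun j => abs_of_nonneg (by positivity)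
  simp only [h4] at h1
  rw [← Real.rpow_le_rpow_iff (z := P / 2) (by positivity) (by positivity) (by linarith)]
  refine h1.trans (le_of_eq ?_)
  rw [Real.mul_rpow (by positivity) (by positivity), Real.div_rpow hN0.le (by positivity),
    ENNReal.toReal_inv, ← hP]
  have h5 : ∀ t : ℝ, 0 ≤ t → (t ^ 2) ^ (P / 2) = t ^ P := fun t ht => by
    rw [← Real.rpow_natCast, ← Real.rpow_mul ht]
    congr 1
    push_cast
    ring
  rw [h5 _ (norm_nonneg _), h5 _ (by positivity), Real.rpow_inv_rpow hN0.le (by linarith),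
    Real.rpow_sub hN0, Real.rpow_one]

end LpNorm

section LowerBound

theorem sum_norm_sq_diag_le {N : ℕ} (L : Submodule ℂ (EuclideanSpace ℂ (Fin N)))
    {z : Fin N → EuclideanSpace ℂ (Fin N)} (hz : ∀ i, z i ∈ L) {B : ℝ}
    (hB : ∀ i, ‖z i‖ ^ 2 ≤ B) :
    ∑ i, ‖z i i‖ ^ 2 ≤ Module.finrank ℂ L * B := by
  set e := EuclideanSpace.basisFun (Fin N) ℂ
  have htr : ∑ i, ‖L.starProjection (e i)‖ ^ 2 = Module.finrank ℂ L := by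
    have h1 : LinearMap.IsProj L (L.starProjection : EuclideanSpace ℂ (Fin N) →ₗ[ℂ] _) :=
      ⟨fun x => L.starProjection_apply_mem x, fun x hx => Submodule.starProjection_eq_self_iff.2 hx⟩
    have h2 := h1.trace
    rw [LinearMap.trace_eq_sum_inner _ e] at h2
    have h3 : ∀ i, ((‖L.starProjection (e i)‖ ^ 2 : ℝ) : ℂ) =
        inner ℂ (e i) ((L.starProjection : EuclideanSpace ℂ (Fin N) →ₗ[ℂ] _) (e i)) := by
      intro i
      have h4 : L.starProjection (L.starProjection (e i)) = L.starProjection (e i) :=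
        Submodule.starProjection_eq_self_iff.2 (L.starProjection_apply_mem _)
      calc ((‖L.starProjection (e i)‖ ^ 2 : ℝ) : ℂ)
          = inner ℂ (L.starProjection (e i)) (L.starProjection (e i)) := by
            rw [inner_self_eq_norm_sq_to_K]; norm_cast
        _ = inner ℂ (e i) (L.starProjection (e i)) := by
            rw [Submodule.inner_starProjection_left_eq_right, h4]
    simp only [← h3] at h2
    exact_mod_cast h2
  rw [← htr, Finset.sum_mul]
  refine Finset.sum_le_sum fun i _ => ?_
  have h1 : z i i = inner ℂ (L.starProjection (e i)) (z i) := by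
    rw [Submodule.inner_starProjection_left_eq_right,
      Submodule.starProjection_eq_self_iff.2 (hz i)]
    simp [e, EuclideanSpace.inner_single_left]
  rw [h1]
  calc _ ≤ (‖L.starProjection (e i)‖ * ‖z i‖) ^ 2 := by
        gcongr
        exact norm_inner_le_norm _ _
    _ ≤ _ := by
        rw [mul_pow]
        gcongr
        exact hB i

theorem div_sqrt_le_of_mul_sq_le {N k W ε : ℝ} (hk0 : 0 < k) (hkN : 4 * k ≤ N) (hW0 : 0 < W)
    (hε0 : 0 ≤ ε) (hε : ε < 1 / 6)
    (hkey : N * (1 - ε) ^ 2 ≤ k * ((1 + ε) ^ 2 + N / W ^ 2 * ε ^ 2)) :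
    1 / 6 * (W / √k) ≤ ε := by
  have hN0 : 0 < N := by linarith
  have h1 : (25 / 36 : ℝ) ≤ (1 - ε) ^ 2 := by nlinarith
  have h2 : (1 + ε) ^ 2 ≤ (49 / 36 : ℝ) := by nlinarith
  have h3 : N / 3 ≤ N * (k * ε ^ 2 / W ^ 2) := by
    have e1 : N * (25 / 36) ≤ N * (1 - ε) ^ 2 := by gcongr
    have e2 : k * (1 + ε) ^ 2 ≤ k * (49 / 36) := by gcongr
    have e3 : k * (N / W ^ 2 * ε ^ 2) = N * (k * ε ^ 2 / W ^ 2) := by field_simp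
    rw [mul_add, e3] at hkey
    linarith
  have h4 : (1 / 3 : ℝ) ≤ k * ε ^ 2 / W ^ 2 := by
    refine le_of_mul_le_mul_left ?_ hN0
    linarith
  rw [le_div_iff₀ (by positivity)] at h4
  rw [← mul_div_assoc, div_le_iff₀ (Real.sqrt_pos.2 hk0)]
  refine (sq_le_sq₀ (by positivity) (by positivity)).1 ?_
  rw [mul_pow, mul_pow, Real.sq_sqrt hk0.le]
  nlinarith [sq_nonneg W]

theorem PiLp.sum_norm_sq_diag_le {p : ℝ≥0∞} [Fact (1 ≤ p)] {N : ℕ}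
    (L : Submodule ℂ (PiLp p fun _ : Fin N => ℂ)) {z : Fin N → PiLp p fun _ : Fin N => ℂ}
    (hz : ∀ i, z i ∈ L) {B : ℝ} (hB : ∀ i, ∑ j, ‖z i j‖ ^ 2 ≤ B) :
    ∑ i, ‖z i i‖ ^ 2 ≤ Module.finrank ℂ L * B := by
  obtain ⟨E, hE⟩ : ∃ E : (PiLp p fun _ : Fin N => ℂ) ≃ₗ[ℂ] EuclideanSpace ℂ (Fin N),
      ∀ x i, E x i = x i :=
    ⟨(WithLp.linearEquiv p ℂ (Fin N → ℂ)).trans (WithLp.linearEquiv 2 ℂ (Fin N → ℂ)).symm,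
      fun _ _ => rfl⟩
  have h := _root_.sum_norm_sq_diag_le (L.map (E : _ →ₗ[ℂ] EuclideanSpace ℂ (Fin N)))
    (z := fun i => E (z i)) (fun i => Submodule.mem_map_of_mem (hz i)) (B := B) fun i => by
      rw [EuclideanSpace.norm_sq_eq]
      simpa only [hE] using hB i
  rw [LinearEquiv.finrank_map_eq] at h
  simpa only [hE] using h

/-- If a subspace `L` of dimension at most `N / 4` approximates the standard unit vectors up to
`ε` in `ℓ_p`, then `ε` cannot be small. -/
theorem min_le_of_approx_single {p : ℝ≥0∞} [Fact (1 ≤ p)] (hp2 : 2 < p) (hp : p ≠ ∞) {N k : ℕ}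
    (hk : 1 ≤ k) (hkN : 4 * k ≤ N) {L : Submodule ℂ (PiLp p fun _ : Fin N => ℂ)}
    (hL : Module.finrank ℂ L ≤ k) {ε : ℝ}
    (h : ∀ i, ∃ z ∈ L, ‖PiLp.single p i (1 : ℂ) - z‖ ≤ ε) :
    1 / 6 * min 1 ((N : ℝ) ^ (p⁻¹).toReal * (k : ℝ) ^ (-(1/2) : ℝ)) ≤ ε := by
  have hN : 1 ≤ N := by omega
  have hN0 : (0 : ℝ) < N := by exact_mod_cast hN
  have hk0 : (0 : ℝ) < k := by exact_mod_cast hk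
  have hkN' : (4 : ℝ) * k ≤ N := by exact_mod_cast hkN
  choose z hzL hz using h
  have hε0 : 0 ≤ ε := (norm_nonneg _).trans (hz ⟨0, hN⟩)
  rcases le_or_gt (1 / 6) ε with hε | hε
  · exact le_trans (mul_le_of_le_one_right (by norm_num) (min_le_left _ _)) hε
  have hdiag : ∀ i, 1 - ε ≤ ‖z i i‖ ∧ ‖z i i‖ ≤ 1 + ε := by
    intro i
    have h1 : ‖1 - z i i‖ ≤ ε := by
      have h0 := (PiLp.norm_apply_le _ i).trans (hz i)
      rwa [PiLp.sub_apply, PiLp.single_apply, if_pos rfl] at h0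
    have h2 := norm_sub_norm_le (1 : ℂ) (z i i)
    have h3 := norm_sub_norm_le (z i i) (1 : ℂ)
    rw [norm_sub_rev] at h3
    rw [norm_one] at h2 h3
    constructor <;> linarith
  obtain ⟨W, hW⟩ : ∃ W, W = (N : ℝ) ^ (p⁻¹).toReal := ⟨_, rfl⟩
  have hW0 : 0 < W := hW ▸ Real.rpow_pos_of_pos hN0 _
  have hB : ∀ i, ∑ j, ‖z i j‖ ^ 2 ≤ (1 + ε) ^ 2 + N / W ^ 2 * ε ^ 2 := by
    intro i
    have h1 := sum_norm_sq_le hp2 hp hN (PiLp.single p i (1 : ℂ) - z i)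
    rw [← hW] at h1
    have h2 : N / W ^ 2 * ‖PiLp.single p i (1 : ℂ) - z i‖ ^ 2 ≤
        N / W ^ 2 * ε ^ 2 :=
      mul_le_mul_of_nonneg_left (pow_le_pow_left₀ (norm_nonneg _) (hz i) 2) (by positivity)
    have h3 : ∑ j, ‖z i j‖ ^ 2 ≤ ‖z i i‖ ^ 2 +
        ∑ j, ‖(PiLp.single p i (1 : ℂ) - z i : PiLp p fun _ : Fin N => ℂ) j‖ ^ 2 := by
      rw [← Finset.add_sum_erase _ _ (Finset.mem_univ i)]
      refine add_le_add_right (le_trans (le_of_eq (Finset.sum_congr rfl fun j hj => ?_))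
        (Finset.sum_le_sum_of_subset_of_nonneg (Finset.erase_subset i _)
          fun _ _ _ => sq_nonneg _)) _
      simp [Finset.ne_of_mem_erase hj]
    have h4 : ‖z i i‖ ^ 2 ≤ (1 + ε) ^ 2 := pow_le_pow_left₀ (norm_nonneg _) (hdiag i).2 2
    linarith
  have hsum := PiLp.sum_norm_sq_diag_le L hzL hB
  have hlow : (N : ℝ) * (1 - ε) ^ 2 ≤ ∑ i, ‖z i i‖ ^ 2 := by
    have : ∀ i ∈ Finset.univ, (1 - ε) ^ 2 ≤ ‖z i i‖ ^ 2 := fun i _ =>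
      pow_le_pow_left₀ (by linarith) (hdiag i).1 2
    simpa using Finset.sum_le_sum this
  have hfin : (Module.finrank ℂ L : ℝ) ≤ k := by exact_mod_cast hL
  have hkey : (N : ℝ) * (1 - ε) ^ 2 ≤ k * ((1 + ε) ^ 2 + N / W ^ 2 * ε ^ 2) :=
    hlow.trans (hsum.trans (mul_le_mul_of_nonneg_right hfin (by positivity)))
  refine (mul_le_mul_of_nonneg_left (min_le_right _ _) (by norm_num)).trans ?_
  rw [← hW, Real.rpow_neg hk0.le, ← Real.sqrt_eq_rpow, ← div_eq_mul_inv]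
  exact div_sqrt_le_of_mul_sq_le hk0 hkN' hW0 hε0 hε hkey

end LowerBound

section Kolmogorov

theorem kolmogorovNumber_le {X Y : Type*} [NormedAddCommGroup X] [NormedSpace ℂ X]
    [NormedAddCommGroup Y] [NormedSpace ℂ Y] (T : X →L[ℂ] Y) {k : ℕ} (L : Submodule ℂ Y)
    (hL : Module.rank ℂ L < (k : Cardinal)) {r : ℝ}
    (hr : ∀ x : X, ‖x‖ ≤ 1 → ⨅ z : L, ‖T x - (z : Y)‖ ≤ r) : kolmogorovNumber T k ≤ r := by
  have hne : Nonempty {x : X // ‖x‖ ≤ 1} := ⟨⟨0, by simp⟩⟩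
  have h : (⨆ x : {x : X // ‖x‖ ≤ 1}, ⨅ z : L, ‖T x.1 - (z : Y)‖) ≤ r :=
    ciSup_le fun x => hr x.1 x.2
  refine (csInf_le ⟨0, ?_⟩ ?_).trans h
  · rintro _ ⟨L', -, rfl⟩
    exact Real.iSup_nonneg fun x => Real.iInf_nonneg fun z => norm_nonneg _
  · exact ⟨L, hL, rfl⟩

theorem le_kolmogorovNumber {X Y : Type*} [NormedAddCommGroup X] [NormedSpace ℂ X]
    [NormedAddCommGroup Y] [NormedSpace ℂ Y] (T : X →L[ℂ] Y) {k : ℕ} (hk : 1 ≤ k) {c : ℝ}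
    (hc : ∀ (L : Submodule ℂ Y) (ε : ℝ), Module.rank ℂ L < (k : Cardinal) →
      (∀ x : X, ‖x‖ ≤ 1 → ∃ z ∈ L, ‖T x - z‖ ≤ ε) → c ≤ ε) : c ≤ kolmogorovNumber T k := by
  refine le_csInf ⟨_, ⊥, ?_, rfl⟩ ?_
  · rw [rank_bot]
    exact_mod_cast hk
  rintro _ ⟨L, hL, rfl⟩
  refine le_of_forall_gt_imp_ge_of_dense fun ε hε => hc L ε hL fun x hx => ?_
  have hbdd : BddAbove (Set.range fun x : {x : X // ‖x‖ ≤ 1} => ⨅ z : L, ‖T x.1 - (z : Y)‖) := by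
    refine ⟨‖T‖, ?_⟩
    rintro _ ⟨x, rfl⟩
    refine (ciInf_le ⟨0, ?_⟩ (0 : L)).trans ?_
    · rintro _ ⟨z, rfl⟩
      exact norm_nonneg _
    · simpa using (T.le_opNorm x.1).trans (mul_le_of_le_one_right (norm_nonneg T) x.2)
  obtain ⟨z, hz⟩ := exists_lt_of_ciInf_lt ((le_ciSup hbdd ⟨x, hx⟩).trans_lt hε)
  exact ⟨z, z.2, hz.le⟩

end Kolmogorov

/-- If `1 ≤ p₁ < 2 < p₂ < ∞`, then
`d_k(id : ℓ_{p₁}^N → ℓ_{p₂}^N) ∼ min(1, N^{1/p₂} k^{-1/2})` for `4k ≤ N`. -/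
theorem stmt5 (p₁ p₂ : ℝ≥0∞) [Fact (1 ≤ p₁)] [Fact (1 ≤ p₂)]
    (h₁ : p₁ < 2) (h₂ : 2 < p₂) (h₃ : p₂ < ∞) :
    ∃ c₁ c₂ : ℝ, 0 < c₁ ∧ c₁ ≤ c₂ ∧
      ∀ N k : ℕ, 1 ≤ k → 4 * k ≤ N →
        c₁ * min 1 ((N : ℝ) ^ ((p₂⁻¹).toReal) * (k : ℝ) ^ (-(1/2) : ℝ))
            ≤ kolmogorovNumber (lpId p₁ p₂ N) k ∧
        kolmogorovNumber (lpId p₁ p₂ N) k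
            ≤ c₂ * min 1 ((N : ℝ) ^ ((p₂⁻¹).toReal) * (k : ℝ) ^ (-(1/2) : ℝ)) := by
  have h₂t : p₂ ≠ ∞ := h₃.ne
  have h₁t : p₁ ≠ ∞ := (h₁.trans_le le_top).ne
  obtain ⟨C, hC, hCA⟩ := exists_signs_kernel p₂ h₂t
  refine ⟨1 / 6, max 1 (4 * C), by norm_num, le_max_of_le_left (by norm_num), fun N k hk hkN => ?_⟩
  have hN : 1 ≤ N := by omega
  have hN1 : (1 : ℝ) ≤ N := by exact_mod_cast hN
  have hk0 : (0 : ℝ) < k := by exact_mod_cast hk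
  have hW1 : 1 ≤ (N : ℝ) ^ (p₂⁻¹).toReal := Real.one_le_rpow hN1 ENNReal.toReal_nonneg
  constructor
  · refine le_kolmogorovNumber _ hk fun L ε hL happ => ?_
    refine min_le_of_approx_single h₂ h₂t hk hkN (L := L) ?_ fun i => ?_
    · rw [← Module.finrank_eq_rank] at hL
      exact_mod_cast hL.le
    · refine happ (PiLp.single p₁ i 1) (le_of_eq ?_)
      have := PiLp.norm_single p₁ (fun _ : Fin N => ℂ) i 1
      rwa [norm_one] at this
  · have hone : kolmogorovNumber (lpId p₁ p₂ N) k ≤ 1 := by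
      refine kolmogorovNumber_le _ ⊥ ?_ fun x hx => ?_
      · rw [rank_bot]
        exact_mod_cast hk
      · refine (ciInf_le ⟨0, ?_⟩ 0).trans ?_
        · rintro _ ⟨z, rfl⟩
          exact norm_nonneg _
        · simpa using norm_lpId_le_one (h₁.trans h₂).le h₂t hx
    have hpow : kolmogorovNumber (lpId p₁ p₂ N) k ≤
        max 1 (4 * C) * ((N : ℝ) ^ (p₂⁻¹).toReal * (k : ℝ) ^ (-(1/2) : ℝ)) := by
      rcases hk.eq_or_lt with rfl | hk2
      · refine hone.trans ?_
        rw [Nat.cast_one, Real.one_rpow, mul_one]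
        exact one_le_mul_of_one_le_of_one_le (le_max_left _ _) hW1
      · obtain ⟨m, rfl⟩ : ∃ m, k = m + 1 := ⟨k - 1, by omega⟩
        have hm : 1 ≤ m := by omega
        have hm1 : (1 : ℝ) ≤ m := by exact_mod_cast hm
        obtain ⟨A, hA⟩ := hCA m N hm hN
        have hbound : kolmogorovNumber (lpId p₁ p₂ N) (m + 1) ≤
            2 * (C * ((N : ℝ) ^ (p₂⁻¹).toReal / √m)) := by
          refine kolmogorovNumber_le _ (Submodule.span ℂ
            (Set.range fun i => (WithLp.toLp p₂ fun j => ((A i j : ℤ) : ℂ)))) ?_ fun x hx => ?_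
          · refine (rank_span_le _).trans_lt (Cardinal.mk_range_le.trans_lt ?_)
            rw [Cardinal.mk_fin]
            exact_mod_cast Nat.lt_succ_self m
          · refine iInf_norm_sub_span_signs_le hA (fun j => x j) ?_
            have hp₁ : p₁.toReal ≤ 2 := by
              simpa using (ENNReal.toReal_le_toReal h₁t ENNReal.ofNat_ne_top).2 h₁.le
            simpa using sum_norm_rpow_le_one h₁t hx hp₁
        refine hbound.trans ?_
        rw [Real.rpow_neg hk0.le, ← Real.sqrt_eq_rpow, ← div_eq_mul_inv]
        have hsqrt : √((m + 1 : ℕ) : ℝ) ≤ 2 * √m := by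
          rw [Real.sqrt_le_iff]
          refine ⟨by positivity, ?_⟩
          rw [mul_pow, Real.sq_sqrt (by linarith)]
          push_cast
          linarith
        have hm0 : 0 < √(m : ℝ) := Real.sqrt_pos.2 (by linarith)
        calc 2 * (C * ((N : ℝ) ^ (p₂⁻¹).toReal / √m))
            = 4 * C * ((N : ℝ) ^ (p₂⁻¹).toReal / (2 * √m)) := by
              field_simp
              norm_num
          _ ≤ max 1 (4 * C) * ((N : ℝ) ^ (p₂⁻¹).toReal / √((m + 1 : ℕ) : ℝ)) := by
              gcongr
              exact le_max_right _ _
    rw [mul_min_of_nonneg _ _ (by positivity)]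
    exact le_min (hone.trans (by rw [mul_one]; exact le_max_left _ _)) hpow
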